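/- Let d ≥ 1, let T be a d×d real matrix with nonnegative entries whose row sums are all strictly less than 1. Let Q = diag(q_1,…,q_d) with q_i ∈ (0,1], and let θ1 ∈ [0,1), θ2 ∈ [0,1]. Then the matrices I_d − (I_d−Q)θ1, I_d − (QTθ2 + (I_d−Q)θ1), and I_d − T·Qθ2(I_d − (I_d−Q)θ1)^{−1} are all invertible, and θ2 (I_d − (QTθ2 + (I_d−Q)θ1))^{−1} Q = D_g (I_d − T D_g)^{−1}, where D_g = Qθ2 (I_d − (I_d−Q)θ1)^{−1}. -/

import Mathlib

open Matrix

/-- For a strictly substochastic matrix `A`, the matrix `1 - A` is invertible. -/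
theorem isUnit_one_sub_of_row_sum_lt_one {n : Type*} [Fintype n] [DecidableEq n]
    {A : Matrix n n ℝ} (h0 : ∀ i j, 0 ≤ A i j) (h1 : ∀ i, ∑ j, A i j < 1) :
    IsUnit (1 - A) := by
  rw [Matrix.isUnit_iff_isUnit_det, isUnit_iff_ne_zero]
  refine det_ne_zero_of_sum_row_lt_diag fun k => ?_
  have hk : A k k + ∑ j ∈ Finset.univ.erase k, A k j < 1 := by
    rw [Finset.add_sum_erase _ _ (Finset.mem_univ k)]
    exact h1 k
  have hoff : ∑ j ∈ Finset.univ.erase k, ‖(1 - A) k j‖ = ∑ j ∈ Finset.univ.erase k, A k j := by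
    refine Finset.sum_congr rfl fun j hj => ?_
    rw [Matrix.sub_apply, Matrix.one_apply_ne (Finset.ne_of_mem_erase hj).symm, zero_sub,
      norm_neg, Real.norm_of_nonneg (h0 k j)]
  rw [hoff, Matrix.sub_apply, Matrix.one_apply_eq]
  exact lt_of_lt_of_le (by linarith) (Real.le_norm_self _)

/-- Push-through identity: if `M * D = B` with `M - B * T` invertible, then `1 - T * D` is
invertible and `(M - B * T)⁻¹ * B = D * (1 - T * D)⁻¹`. -/
theorem inv_sub_mul_mul_eq_mul_inv_one_sub {n R : Type*} [Fintype n] [DecidableEq n]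
    [CommRing R] {M D B T : Matrix n n R} (hMD : M * D = B) (h : IsUnit (M - B * T)) :
    IsUnit (1 - T * D) ∧ (M - B * T)⁻¹ * B = D * (1 - T * D)⁻¹ := by
  have hfac : M - B * T = M * (1 - D * T) := by rw [← hMD]; noncomm_ring
  have hT : IsUnit (1 - T * D) := by
    rw [Matrix.isUnit_iff_isUnit_det] at h ⊢
    rw [hfac, Matrix.det_mul, Matrix.det_one_sub_mul_comm] at h
    exact isUnit_of_mul_isUnit_right h
  refine ⟨hT, ?_⟩
  have key : (M - B * T) * D = B * (1 - T * D) := by rw [← hMD]; noncomm_ring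
  rw [Matrix.isUnit_iff_isUnit_det] at h hT
  calc (M - B * T)⁻¹ * B = (M - B * T)⁻¹ * (B * (1 - T * D) * (1 - T * D)⁻¹) := by
        rw [Matrix.mul_nonsing_inv_cancel_right _ _ hT]
    _ = D * (1 - T * D)⁻¹ := by
        rw [← key, Matrix.mul_assoc, Matrix.nonsing_inv_mul_cancel_left _ _ h]

/-- Theorem 2 (geometric rewards), key matrix identity:
`θ2 (I − (QTθ2 + (I−Q)θ1))^{−1} Q = D_g (I − T D_g)^{−1}` where
`D_g = Qθ2 (I − (I−Q)θ1)^{−1}`. -/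
theorem geometric_rrdph_key_identity
    (d : ℕ) (hd : 1 ≤ d)
    (T : Matrix (Fin d) (Fin d) ℝ)
    (hT0 : ∀ i j, 0 ≤ T i j)
    (hTrow : ∀ i, ∑ j, T i j < 1)
    (q : Fin d → ℝ) (hq : ∀ i, q i ∈ Set.Ioc (0 : ℝ) 1)
    (θ1 θ2 : ℝ) (hθ1 : θ1 ∈ Set.Ico (0 : ℝ) 1) (hθ2 : θ2 ∈ Set.Icc (0 : ℝ) 1)
    (Q : Matrix (Fin d) (Fin d) ℝ) (hQ : Q = Matrix.diagonal q)
    (Dg : Matrix (Fin d) (Fin d) ℝ)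
    (hDg : Dg = θ2 • (Q * (1 - θ1 • (1 - Q))⁻¹)) :
    IsUnit (1 - θ1 • (1 - Q)) ∧
    IsUnit (1 - (θ2 • (Q * T) + θ1 • (1 - Q))) ∧
    IsUnit (1 - T * Dg) ∧
    θ2 • ((1 - (θ2 • (Q * T) + θ1 • (1 - Q)))⁻¹ * Q) = Dg * (1 - T * Dg)⁻¹ := by
  have hQij (i j : Fin d) : (θ1 • (1 - Q)) i j = if i = j then θ1 * (1 - q i) else 0 := by
    subst hQ
    by_cases hij : i = j <;> simp [hij]
  have hdiag0 (i j : Fin d) : 0 ≤ (θ1 • (1 - Q)) i j := by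
    rw [hQij]
    split_ifs
    exacts [mul_nonneg hθ1.1 (sub_nonneg.2 (hq i).2), le_rfl]
  have hdiag_sum (i : Fin d) : ∑ j, (θ1 • (1 - Q)) i j = θ1 * (1 - q i) := by
    simp [hQij]
  have hQT (i j : Fin d) : (θ2 • (Q * T)) i j = θ2 * q i * T i j := by
    simp [hQ, Matrix.diagonal_mul, mul_assoc]
  have hdiag_le (i : Fin d) : θ1 * (1 - q i) ≤ 1 - q i :=
    mul_le_of_le_one_left (sub_nonneg.2 (hq i).2) hθ1.2.le
  have hM : IsUnit (1 - θ1 • (1 - Q)) := by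
    refine isUnit_one_sub_of_row_sum_lt_one hdiag0 fun i => ?_
    rw [hdiag_sum]
    linarith [hdiag_le i, (hq i).1]
  have hK : IsUnit (1 - (θ2 • (Q * T) + θ1 • (1 - Q))) := by
    refine isUnit_one_sub_of_row_sum_lt_one (fun i j => ?_) fun i => ?_
    · rw [Matrix.add_apply, hQT]
      exact add_nonneg (mul_nonneg (mul_nonneg hθ2.1 (hq i).1.le) (hT0 i j)) (hdiag0 i j)
    · simp only [Matrix.add_apply, Finset.sum_add_distrib, hdiag_sum, hQT, ← Finset.mul_sum]
      have hle : θ2 * q i * ∑ j, T i j ≤ q i * ∑ j, T i j :=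
        mul_le_mul_of_nonneg_right (mul_le_of_le_one_left (hq i).1.le hθ2.2)
          (Finset.sum_nonneg fun j _ => hT0 i j)
      have hlt : q i * ∑ j, T i j < q i := mul_lt_of_lt_one_right (hq i).1 (hTrow i)
      linarith [hdiag_le i]
  have hcomm : (1 - θ1 • (1 - Q)) * Q = Q * (1 - θ1 • (1 - Q)) := by
    simp [sub_mul, mul_sub]
  have hMD : (1 - θ1 • (1 - Q)) * Dg = θ2 • Q := by
    rw [hDg, Matrix.mul_smul, ← Matrix.mul_assoc, hcomm, Matrix.mul_nonsing_inv_cancel_right _ _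
      ((Matrix.isUnit_iff_isUnit_det _).1 hM)]
  have hsub : 1 - (θ2 • (Q * T) + θ1 • (1 - Q)) = 1 - θ1 • (1 - Q) - (θ2 • Q) * T := by
    rw [Matrix.smul_mul]
    abel
  refine ⟨hM, hK, ?_⟩
  rw [hsub] at hK ⊢
  rw [← Matrix.mul_smul]
  exact inv_sub_mul_mul_eq_mul_inv_one_sub hMD hK
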